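/- Let n ≥ 2 be an integer and let p be a real number with n < p < ∞. Set C(n,p) = (2^{n−1} n σₙ)^{−1/p} ( Γ((p−n)/(2(p−1))) Γ((n−1)/(p−1)) / Γ((p+n−2)/(2(p−1))) )^{(p−1)/p}. Then for every smooth function u : ℝⁿ → ℝ with compact support contained in the open unit ball Bⁿ, one has sup_{x∈Bⁿ} |u(x)| ≤ C(n,p) ( ∫_{Bⁿ} ((1−|x|²)/2)^p |∇u(x)|^p (2/(1−|x|²))^n dx )^{1/p}. -/

import Mathlib

open Real MeasureTheory

/-- Volume of the Euclidean unit ball in `ℝⁿ`. -/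
noncomputable def unitBallVol (n : ℕ) : ℝ := π ^ ((n : ℝ) / 2) / Real.Gamma ((n : ℝ) / 2 + 1)

/-- The sharp constant `C(n,p)` in the hyperbolic Morrey-type inequality for `p > n`. -/
noncomputable def hyperbolicMorreyConst (n : ℕ) (p : ℝ) : ℝ :=
  (2 ^ ((n : ℝ) - 1) * (n : ℝ) * unitBallVol n) ^ (-(1 / p)) *
    (Real.Gamma ((p - (n : ℝ)) / (2 * (p - 1))) * Real.Gamma (((n : ℝ) - 1) / (p - 1)) /
      Real.Gamma ((p + (n : ℝ) - 2) / (2 * (p - 1)))) ^ ((p - 1) / p)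

open Set Metric ENNReal

section Polar

variable {E : Type*} [NormedAddCommGroup E] [NormedSpace ℝ E] [FiniteDimensional ℝ E]
  [MeasurableSpace E] [BorelSpace E]

open Module in
/-- Integration in polar coordinates for nonnegative functions. -/
theorem lintegral_eq_lintegral_toSphere [Nontrivial E] (μ : Measure E) [μ.IsAddHaarMeasure]
    {f : E → ℝ≥0∞} (hf : Measurable f) :
    ∫⁻ x, f x ∂μ = ∫⁻ θ : sphere (0 : E) 1, (∫⁻ r in Ioi (0 : ℝ),
      ENNReal.ofReal (r ^ (finrank ℝ E - 1)) * f (r • (θ : E))) ∂μ.toSphere := by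
  have hmeas : Measurable fun q : sphere (0 : E) 1 × Ioi (0 : ℝ) => f ((q.2 : ℝ) • (q.1 : E)) := by
    fun_prop
  calc
    ∫⁻ x, f x ∂μ = ∫⁻ x : ({(0)}ᶜ : Set E), f x ∂(μ.comap (↑)) := by
      rw [lintegral_subtype_comap (measurableSet_singleton _).compl f,
        restrict_compl_singleton]
    _ = ∫⁻ q, f ((q.2 : ℝ) • (q.1 : E)) ∂μ.toSphere.prod (.volumeIoiPow (finrank ℝ E - 1)) := by
      rw [← μ.measurePreserving_homeomorphUnitSphereProd.lintegral_comp_emb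
        (Homeomorph.measurableEmbedding _)]
      refine lintegral_congr fun x => ?_
      have hx : ‖(x : E)‖ ≠ 0 := norm_ne_zero_iff.2 x.2
      simp [smul_smul, hx]
    _ = _ := by
      rw [lintegral_prod _ hmeas.aemeasurable]
      refine lintegral_congr fun θ => ?_
      have h1 : Measurable fun r : Ioi (0 : ℝ) => ENNReal.ofReal ((r : ℝ) ^ (finrank ℝ E - 1)) := by
        fun_prop
      rw [Measure.volumeIoiPow, lintegral_withDensity_eq_lintegral_mul _ h1 (by fun_prop),
        ← lintegral_subtype_comap measurableSet_Ioi]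
      rfl

end Polar

/-- A Beta integral in the variable `r = √t`. -/
theorem lintegral_Ioo_rpow_mul_one_sub_sq_rpow {α β : ℝ} (hα : 0 < α) (hβ : 0 < β)
    (hαβ : α + β = 1) :
    ∫⁻ r in Ioo (0 : ℝ) 1, ENNReal.ofReal (r ^ (-α) * ((1 - r ^ 2) / 2) ^ (-β)) =
      ENNReal.ofReal (2 ^ (-α) * ProbabilityTheory.beta (β / 2) α) := by
  have hB := ProbabilityTheory.beta_pos (half_pos hβ) hα
  set B := ProbabilityTheory.beta (β / 2) α
  have himg : (fun r : ℝ => r ^ 2) '' Ioo 0 1 = Ioo 0 1 := by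
    ext t
    constructor
    · rintro ⟨r, ⟨h0, h1⟩, rfl⟩
      exact ⟨by positivity, pow_lt_one₀ h0.le h1 two_ne_zero⟩
    · rintro ⟨h0, h1⟩
      exact ⟨√t, ⟨Real.sqrt_pos.2 h0, (Real.sqrt_lt' one_pos).2 (by simpa using h1)⟩,
        Real.sq_sqrt h0.le⟩
  have h1 := ProbabilityTheory.lintegral_betaPDF_eq_one (half_pos hβ) hα
  rw [ProbabilityTheory.lintegral_betaPDF, ← himg,
    lintegral_image_eq_lintegral_abs_deriv_mul measurableSet_Ioo
      (f := fun r : ℝ => r ^ 2) (f' := fun r => 2 * r)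
      (fun r _ => by simpa using (hasDerivAt_pow 2 r).hasDerivWithinAt)
      (fun a ha b hb hab => (pow_left_inj₀ ha.1.le hb.1.le two_ne_zero).1 hab)] at h1
  have h2 : ∀ r ∈ Ioo (0 : ℝ) 1, ENNReal.ofReal (r ^ (-α) * ((1 - r ^ 2) / 2) ^ (-β)) =
      ENNReal.ofReal (2 ^ (-α) * B) * (ENNReal.ofReal |2 * r| *
        ENNReal.ofReal (1 / B * (r ^ 2) ^ (β / 2 - 1) * (1 - r ^ 2) ^ (α - 1))) := by
    intro r ⟨hr0, hr1⟩
    have hr2 : 0 < 1 - r ^ 2 := sub_pos.2 (pow_lt_one₀ hr0.le hr1 two_ne_zero)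
    rw [abs_of_pos (by positivity), ← ENNReal.ofReal_mul (by positivity),
      ← ENNReal.ofReal_mul (by positivity)]
    congr 1
    have e1 : (r ^ 2) ^ (β / 2 - 1) = r ^ (-α) / r := by
      rw [← Real.rpow_natCast, ← Real.rpow_mul hr0.le,
        show ((2 : ℕ) : ℝ) * (β / 2 - 1) = -α - 1 by push_cast; linarith,
        Real.rpow_sub_one hr0.ne']
    have e2 : (2 : ℝ) ^ (-α) = 2 ^ β / 2 := by
      rw [show -α = β - 1 by linarith, Real.rpow_sub_one two_ne_zero]
    have e3 : ((1 - r ^ 2) / 2) ^ (-β) = (1 - r ^ 2) ^ (α - 1) * 2 ^ β := by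
      rw [Real.div_rpow hr2.le two_pos.le, show α - 1 = -β by linarith,
        Real.rpow_neg two_pos.le, div_inv_eq_mul]
    rw [e1, e2, e3]
    field_simp
  rw [setLIntegral_congr_fun measurableSet_Ioo h2, lintegral_const_mul' _ _ ENNReal.ofReal_ne_top,
    h1, mul_one]

section Ball

variable {E : Type*} [NormedAddCommGroup E] [InnerProductSpace ℝ E]

/-- `T` is an isometry of the Poincaré ball that is conformal, with factor `lam`, up to the
boundary. -/
structure IsBallIsometry (T : E → E) (lam : E → ℝ) : Prop where
  hasFDerivAt : ∀ x ∈ closedBall (0 : E) 1, ∃ L : E ≃ₗᵢ[ℝ] E,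
    HasFDerivAt T (lam x • (L : E →L[ℝ] E)) x
  factor_pos : ∀ x ∈ closedBall (0 : E) 1, 0 < lam x
  continuousOn_factor : ContinuousOn lam (closedBall 0 1)
  one_sub_norm_sq : ∀ x ∈ closedBall (0 : E) 1, 1 - ‖T x‖ ^ 2 = lam x * (1 - ‖x‖ ^ 2)
  injOn : InjOn T (ball 0 1)

theorem IsBallIsometry.id : IsBallIsometry (fun x : E => x) fun _ => 1 where
  hasFDerivAt x _ := ⟨.refl ℝ E, by
    rw [one_smul]
    exact hasFDerivAt_id (𝕜 := ℝ) x⟩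
  factor_pos _ _ := one_pos
  continuousOn_factor := continuousOn_const
  one_sub_norm_sq _ _ := by simp
  injOn := injOn_id _

open EuclideanGeometry in
/-- The inversion in a sphere orthogonal to the unit sphere. -/
theorem isBallIsometry_inversion {c : E} (hc : 1 < ‖c‖) :
    IsBallIsometry (inversion c √(‖c‖ ^ 2 - 1)) fun x => (‖c‖ ^ 2 - 1) / ‖x - c‖ ^ 2 := by
  have hR : 0 < ‖c‖ ^ 2 - 1 := by nlinarith
  have hne : ∀ x ∈ closedBall (0 : E) 1, 0 < ‖x - c‖ := by
    intro x hx
    rw [mem_closedBall_zero_iff] at hx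
    have := norm_sub_norm_le c x
    rw [norm_sub_rev] at this
    linarith
  refine ⟨fun x hx => ⟨(Submodule.span ℝ {x - c})ᗮ.reflection, ?_⟩, fun x hx => ?_, ?_,
    fun x hx => ?_, (inversion_injective c (Real.sqrt_pos.2 hR).ne').injOn⟩
  · have h := hasFDerivAt_inversion (R := √(‖c‖ ^ 2 - 1))
      (sub_ne_zero.1 (norm_pos_iff.1 (hne x hx)))
    rwa [div_pow, Real.sq_sqrt hR.le, dist_eq_norm] at h
  · have := hne x hx
    positivity
  · exact continuousOn_const.div (by fun_prop) fun x hx => (pow_pos (hne x hx) 2).ne'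
  · have h := hne x hx
    have e : inversion c √(‖c‖ ^ 2 - 1) x = ((‖c‖ ^ 2 - 1) / ‖x - c‖ ^ 2) • (x - c) + c := by
      rw [inversion, div_pow, Real.sq_sqrt hR.le, dist_eq_norm]
      simp
    have hx2 : ‖x‖ ^ 2 = ‖x - c‖ ^ 2 + 2 * inner ℝ (x - c) c + ‖c‖ ^ 2 := by
      rw [← norm_add_sq_real, sub_add_cancel]
    rw [e, norm_add_sq_real, norm_smul, mul_pow, real_inner_smul_left, hx2, Real.norm_eq_abs,
      sq_abs]
    field_simp
    ring

open EuclideanGeometry in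
/-- The isometries of the Poincaré ball act transitively. -/
theorem exists_isBallIsometry {a : E} (ha : a ∈ ball (0 : E) 1) :
    ∃ T lam, IsBallIsometry T lam ∧ T 0 = a := by
  rcases eq_or_ne a 0 with rfl | ha0
  · exact ⟨_, _, .id, rfl⟩
  have h0 : 0 < ‖a‖ := norm_pos_iff.2 ha0
  rw [mem_ball_zero_iff] at ha
  have hc : ‖(‖a‖ ^ 2)⁻¹ • a‖ = ‖a‖⁻¹ := by
    rw [norm_smul, norm_inv, norm_pow, norm_norm]
    field_simp
  have h1 : 1 < ‖(‖a‖ ^ 2)⁻¹ • a‖ := by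
    rw [hc]; exact (one_lt_inv₀ h0).2 ha
  refine ⟨_, _, isBallIsometry_inversion h1, ?_⟩
  rw [inversion, div_pow, Real.sq_sqrt (by nlinarith), dist_zero_left, hc]
  simp only [vsub_eq_sub, vadd_eq_add, zero_sub, ← smul_neg, smul_smul]
  rw [smul_neg, ← sub_eq_neg_add, ← sub_smul]
  convert one_smul ℝ a using 2
  field_simp
  ring

variable {T : E → E} {lam : E → ℝ}

theorem IsBallIsometry.mapsTo_ball (h : IsBallIsometry T lam) :
    MapsTo T (ball 0 1) (ball 0 1) := by
  intro x hx
  have hx' := ball_subset_closedBall hx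
  rw [mem_ball_zero_iff] at hx ⊢
  have h1 := h.one_sub_norm_sq x hx'
  have h2 : 0 < lam x * (1 - ‖x‖ ^ 2) :=
    mul_pos (h.factor_pos x hx') (by nlinarith [norm_nonneg x])
  nlinarith [norm_nonneg (T x)]

theorem IsBallIsometry.norm_eq_one (h : IsBallIsometry T lam) {x : E} (hx : ‖x‖ = 1) :
    ‖T x‖ = 1 := by
  have h1 := h.one_sub_norm_sq x (by simp [hx])
  rw [hx] at h1
  have : ‖T x‖ ^ 2 = 1 := by linarith
  exact (pow_eq_one_iff_of_nonneg (norm_nonneg _) two_ne_zero).1 this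

theorem IsBallIsometry.continuousOn (h : IsBallIsometry T lam) :
    ContinuousOn T (closedBall 0 1) := fun x hx =>
  let ⟨_, hL⟩ := h.hasFDerivAt x hx
  hL.continuousAt.continuousWithinAt

/-- The value at `T 0` of a function vanishing on the unit sphere is bounded by the integral of its
gradient along any ray through `T 0`. -/
theorem IsBallIsometry.ofReal_abs_le_lintegral (h : IsBallIsometry T lam) {u : E → ℝ}
    (hu : ContDiff ℝ 1 u) (hu0 : ∀ x, ‖x‖ = 1 → u x = 0) {θ : E} (hθ : ‖θ‖ = 1) :
    ENNReal.ofReal |u (T 0)| ≤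
      ∫⁻ r in Ioo (0 : ℝ) 1, ENNReal.ofReal (‖fderiv ℝ u (T (r • θ))‖ * lam (r • θ)) := by
  have hmem : ∀ r ∈ Icc (0 : ℝ) 1, r • θ ∈ closedBall (0 : E) 1 := by
    intro r hr
    rw [mem_closedBall_zero_iff, norm_smul, hθ, mul_one, Real.norm_eq_abs, abs_of_nonneg hr.1]
    exact hr.2
  set φ : ℝ → ℝ := fun r => ‖fderiv ℝ u (T (r • θ))‖ * lam (r • θ) with hφ
  have hsm : ContinuousOn (fun r : ℝ => r • θ) (Icc 0 1) := by fun_prop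
  have hT : ContinuousOn (fun r : ℝ => T (r • θ)) (Icc 0 1) := h.continuousOn.comp hsm hmem
  have hφc : ContinuousOn φ (Icc 0 1) :=
    (((hu.continuous_fderiv one_ne_zero).comp_continuousOn hT).norm).mul
      (h.continuousOn_factor.comp hsm hmem)
  have hφ0 : ∀ r ∈ Icc (0 : ℝ) 1, 0 ≤ φ r := fun r hr =>
    mul_nonneg (norm_nonneg _) (h.factor_pos _ (hmem r hr)).le
  have hder : ∀ r ∈ Icc (0 : ℝ) 1, ∃ d, HasDerivAt (fun r : ℝ => u (T (r • θ))) d r ∧ |d| ≤ φ r := by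
    intro r hr
    obtain ⟨L, hL⟩ := h.hasFDerivAt _ (hmem r hr)
    have h1 : HasDerivAt (fun r : ℝ => r • θ) θ r := by
      simpa using (hasDerivAt_id r).smul_const θ
    have h2 := (hu.differentiable one_ne_zero (T (r • θ))).hasFDerivAt.comp_hasDerivAt r
      (hL.comp_hasDerivAt r h1)
    refine ⟨_, h2, ?_⟩
    rw [← Real.norm_eq_abs]
    refine (ContinuousLinearMap.le_opNorm _ _).trans (le_of_eq ?_)
    simp only [hφ, smul_apply, norm_smul, Real.norm_eq_abs]
    rw [abs_of_pos (h.factor_pos _ (hmem r hr))]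
    simp [hθ]
  choose! d hd hdφ using hder
  have hφi : IntegrableOn φ (Icc 0 1) := hφc.integrableOn_Icc
  have hc : ContinuousOn (fun r : ℝ => u (T (r • θ))) (Icc 0 1) := hu.continuous.comp_continuousOn hT
  have hb : u (T θ) = 0 := hu0 _ (h.norm_eq_one hθ)
  have h1 := intervalIntegral.sub_le_integral_of_hasDeriv_right_of_le zero_le_one hc
    (fun r hr => (hd r (Ioo_subset_Icc_self hr)).hasDerivWithinAt) hφi
    (fun r hr => (abs_le.1 (hdφ r (Ioo_subset_Icc_self hr))).2)
  have h2 := intervalIntegral.sub_le_integral_of_hasDeriv_right_of_le zero_le_one hc.neg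
    (fun r hr => (hd r (Ioo_subset_Icc_self hr)).neg.hasDerivWithinAt) hφi
    (fun r hr => neg_le.1 (abs_le.1 (hdφ r (Ioo_subset_Icc_self hr))).1)
  simp only [Pi.neg_apply, one_smul, zero_smul, hb] at h1 h2
  have h3 : |u (T 0)| ≤ ∫ r in (0 : ℝ)..1, φ r := abs_le.2 ⟨by linarith, by linarith⟩
  refine (ENNReal.ofReal_le_ofReal h3).trans (le_of_eq ?_)
  rw [intervalIntegral.integral_of_le zero_le_one, integral_Ioc_eq_integral_Ioo]
  exact ofReal_integral_eq_lintegral_ofReal (hφi.mono_set Ioo_subset_Icc_self)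
    (ae_restrict_of_forall_mem measurableSet_Ioo fun r hr => hφ0 r (Ioo_subset_Icc_self hr))

theorem abs_det_smul_linearIsometryEquiv [FiniteDimensional ℝ E] (L : E ≃ₗᵢ[ℝ] E) {c : ℝ}
    (hc : 0 ≤ c) : |(c • (L : E →L[ℝ] E)).det| = c ^ Module.finrank ℝ E := by
  have h : |LinearMap.det L.toLinearIsometry.toLinearMap| = 1 := by
    rw [← LinearMap.normDet_eq_abs_det, LinearIsometry.normDet_eq_one]
  rw [ContinuousLinearMap.det, ContinuousLinearMap.toLinearMap_smul, LinearMap.det_smul, abs_mul,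
    abs_of_nonneg (by positivity)]
  exact (congrArg _ h).trans (mul_one _)

/-- Change of variables under an isometry of the Poincaré ball. -/
theorem IsBallIsometry.lintegral_le [FiniteDimensional ℝ E] [MeasurableSpace E] [BorelSpace E]
    (h : IsBallIsometry T lam) (F : E → ℝ≥0∞) :
    ∫⁻ x in ball (0 : E) 1, ENNReal.ofReal (lam x ^ Module.finrank ℝ E) * F (T x) ≤
      ∫⁻ x in ball (0 : E) 1, F x := by
  choose! L hL using h.hasFDerivAt
  have h1 := lintegral_image_eq_lintegral_abs_det_fderiv_mul volume measurableSet_ball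
    (fun x hx => (hL x (ball_subset_closedBall hx)).hasFDerivWithinAt) h.injOn F
  rw [setLIntegral_congr_fun measurableSet_ball fun x hx => by
    rw [← abs_det_smul_linearIsometryEquiv (L x) (h.factor_pos x (ball_subset_closedBall hx)).le],
    ← h1]
  exact lintegral_mono_set h.mapsTo_ball.image_subset

end Ball

section Radial

variable {E : Type*} [NormedAddCommGroup E] [InnerProductSpace ℝ E] [FiniteDimensional ℝ E]
  [MeasurableSpace E] [BorelSpace E] [Nontrivial E]

open Module in
theorem setLIntegral_ball_fun_norm {k : ℝ → ℝ≥0∞} (hk : Measurable k) :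
    ∫⁻ x in ball (0 : E) 1, k ‖x‖ = (volume : Measure E).toSphere univ *
      ∫⁻ r in Ioo (0 : ℝ) 1, ENNReal.ofReal (r ^ (finrank ℝ E - 1)) * k r := by
  have h : ∀ θ : sphere (0 : E) 1, ∫⁻ r in Ioi (0 : ℝ), ENNReal.ofReal (r ^ (finrank ℝ E - 1)) *
      (ball (0 : E) 1).indicator (fun x => k ‖x‖) (r • (θ : E)) =
      ∫⁻ r in Ioo (0 : ℝ) 1, ENNReal.ofReal (r ^ (finrank ℝ E - 1)) * k r := by
    intro θ
    rw [← Ioi_inter_Iio, inter_comm, ← setLIntegral_indicator measurableSet_Iio]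
    refine setLIntegral_congr_fun measurableSet_Ioi fun r hr => ?_
    have hn : ‖r • (θ : E)‖ = r := by simp [norm_smul, abs_of_pos (mem_Ioi.1 hr)]
    by_cases h1 : r < 1 <;> simp [indicator, hn, h1]
  rw [← lintegral_indicator measurableSet_ball, lintegral_eq_lintegral_toSphere volume
    ((by fun_prop : Measurable fun x : E => k ‖x‖).indicator measurableSet_ball),
    lintegral_congr h, lintegral_const, mul_comm]

open Module in
/-- The bound of a function by the Riesz potential of its gradient, transported by an isometry of
the Poincaré ball. -/
theorem IsBallIsometry.toSphere_mul_ofReal_abs_le {T : E → E} {lam : E → ℝ}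
    (h : IsBallIsometry T lam) {u : E → ℝ} (hu : ContDiff ℝ 1 u) (hu0 : ∀ x, ‖x‖ = 1 → u x = 0) :
    (volume : Measure E).toSphere univ * ENNReal.ofReal |u (T 0)| ≤
      ∫⁻ x in ball (0 : E) 1, ENNReal.ofReal (‖fderiv ℝ u (T x)‖ * lam x *
        (‖x‖ ^ (finrank ℝ E - 1))⁻¹) := by
  set A : E → ℝ := (ball (0 : E) 1).indicator fun x => ‖fderiv ℝ u (T x)‖ * lam x with hA
  have hAm : Measurable A := by
    have hc : ContinuousOn (fun x => ‖fderiv ℝ u (T x)‖ * lam x) (ball (0 : E) 1) :=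
      (((hu.continuous_fderiv one_ne_zero).comp_continuousOn
        (h.continuousOn.mono ball_subset_closedBall)).norm).mul
        (h.continuousOn_factor.mono ball_subset_closedBall)
    classical
    rw [hA, ← piecewise_eq_indicator]
    exact hc.measurable_piecewise continuousOn_const measurableSet_ball
  have hAb : ∫⁻ x in ball (0 : E) 1, ENNReal.ofReal (‖fderiv ℝ u (T x)‖ * lam x *
        (‖x‖ ^ (finrank ℝ E - 1))⁻¹) = ∫⁻ x, ENNReal.ofReal (A x * (‖x‖ ^ (finrank ℝ E - 1))⁻¹) := by
    rw [← lintegral_indicator measurableSet_ball]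
    refine lintegral_congr fun x => ?_
    by_cases hx : x ∈ ball (0 : E) 1
    · simp only [hA, indicator_of_mem hx]
    · simp [hA, indicator_of_notMem hx]
  rw [hAb, lintegral_eq_lintegral_toSphere volume (by fun_prop), mul_comm, ← lintegral_const]
  refine lintegral_mono fun θ => ?_
  refine (h.ofReal_abs_le_lintegral hu hu0 (norm_eq_of_mem_sphere θ)).trans ?_
  refine le_of_eq_of_le ?_ (lintegral_mono_set (Ioo_subset_Ioi_self (a := (1 : ℝ))))
  refine setLIntegral_congr_fun measurableSet_Ioo fun r ⟨h0, h1⟩ => ?_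
  have hn : ‖r • (θ : E)‖ = r := by simp [norm_smul, abs_of_pos h0]
  have hm : r • (θ : E) ∈ ball (0 : E) 1 := by rwa [mem_ball_zero_iff, hn]
  have hr : 0 < r ^ (finrank ℝ E - 1) := pow_pos h0 _
  rw [← ENNReal.ofReal_mul hr.le, hn, hA]
  simp only [indicator_of_mem hm]
  congr 1
  field_simp

end Radial

theorem unitBallVol_pos (n : ℕ) : 0 < unitBallVol n :=
  div_pos (Real.rpow_pos_of_pos Real.pi_pos _) (Real.Gamma_pos_of_pos (by positivity))

theorem toSphere_univ_euclideanSpace {n : ℕ} (hn : n ≠ 0) :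
    (volume : Measure (EuclideanSpace ℝ (Fin n))).toSphere univ =
      ENNReal.ofReal (n * unitBallVol n) := by
  have : Nonempty (Fin n) := ⟨⟨0, Nat.pos_of_ne_zero hn⟩⟩
  rw [Measure.toSphere_apply_univ, EuclideanSpace.volume_ball, ENNReal.ofReal_one, one_pow, one_mul,
    finrank_euclideanSpace, Fintype.card_fin, ENNReal.ofReal_mul n.cast_nonneg,
    ENNReal.ofReal_natCast, unitBallVol, Real.sqrt_eq_rpow, ← Real.rpow_mul_natCast Real.pi_pos.le,
    one_div_mul_eq_div]

section Estimate

variable {n : ℕ} {p : ℝ}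

/-- The `L^q` norm of the Riesz kernel with respect to the weight dual to the hyperbolic one. -/
theorem lintegral_riesz_kernel_rpow (hn : 2 ≤ n) (hp : (n : ℝ) < p) :
    ∫⁻ x in ball (0 : EuclideanSpace ℝ (Fin n)) 1,
      ENNReal.ofReal ((‖x‖ ^ (n - 1))⁻¹ * ((1 - ‖x‖ ^ 2) / 2) ^ (-((p - n) / p))) ^
        (p / (p - 1)) =
      ENNReal.ofReal (n * unitBallVol n) * ENNReal.ofReal (2 ^ (-((n - 1) / (p - 1))) *
        ProbabilityTheory.beta ((p - n) / (2 * (p - 1))) ((n - 1) / (p - 1))) := by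
  have hn' : (2 : ℝ) ≤ n := by exact_mod_cast hn
  have hp1 : 0 < p - 1 := by linarith
  have hp0 : 0 < p := by linarith
  have : Nonempty (Fin n) := ⟨⟨0, by omega⟩⟩
  rw [setLIntegral_ball_fun_norm (E := EuclideanSpace ℝ (Fin n)) (k := fun r => ENNReal.ofReal
    ((r ^ (n - 1))⁻¹ * ((1 - r ^ 2) / 2) ^ (-((p - n) / p))) ^ (p / (p - 1))) (by fun_prop),
    toSphere_univ_euclideanSpace (by omega), finrank_euclideanSpace, Fintype.card_fin]
  congr 1
  rw [show (p - n) / (2 * (p - 1)) = (p - n) / (p - 1) / 2 by field_simp,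
    ← lintegral_Ioo_rpow_mul_one_sub_sq_rpow (div_pos (by linarith) hp1)
      (div_pos (by linarith) hp1) (by field_simp; ring)]
  refine setLIntegral_congr_fun measurableSet_Ioo fun r ⟨h0, h1⟩ => ?_
  have hs : 0 < (1 - r ^ 2) / 2 := half_pos (sub_pos.2 (pow_lt_one₀ h0.le h1 two_ne_zero))
  rw [ENNReal.ofReal_rpow_of_nonneg (by positivity) (by positivity),
    ← ENNReal.ofReal_mul (by positivity), Real.mul_rpow (by positivity) (by positivity),
    ← mul_assoc, ← Real.rpow_mul hs.le, ← Real.rpow_natCast, ← Real.rpow_neg h0.le,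
    ← Real.rpow_mul h0.le, ← Real.rpow_add h0]
  push_cast [show 1 ≤ n by omega]
  congr 3
  · field_simp
    ring
  · field_simp

/-- Invariance of the hyperbolic `p`-energy density. -/
theorem IsBallIsometry.energy_density_eq {T : EuclideanSpace ℝ (Fin n) → EuclideanSpace ℝ (Fin n)}
    {lam : EuclideanSpace ℝ (Fin n) → ℝ} (h : IsBallIsometry T lam) (hp : 0 < p) {D : ℝ}
    (hD : 0 ≤ D) {x : EuclideanSpace ℝ (Fin n)} (hx : x ∈ ball (0 : EuclideanSpace ℝ (Fin n)) 1) :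
    (D * lam x * ((1 - ‖x‖ ^ 2) / 2) ^ ((p - n) / p)) ^ p = lam x ^ n *
      (((1 - ‖T x‖ ^ 2) / 2) ^ p * D ^ p * (2 / (1 - ‖T x‖ ^ 2)) ^ (n : ℝ)) := by
  have hl := h.factor_pos x (ball_subset_closedBall hx)
  have hT := h.one_sub_norm_sq x (ball_subset_closedBall hx)
  rw [mem_ball_zero_iff] at hx
  have hs : 0 < (1 - ‖x‖ ^ 2) / 2 :=
    half_pos (sub_pos.2 (pow_lt_one₀ (norm_nonneg x) hx two_ne_zero))
  rw [← inv_div (1 - ‖T x‖ ^ 2), hT, mul_div_assoc]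
  set s := (1 - ‖x‖ ^ 2) / 2
  rw [Real.inv_rpow (by positivity), Real.mul_rpow (by positivity) (by positivity),
    Real.mul_rpow hD hl.le, ← Real.rpow_mul hs.le, div_mul_cancel₀ _ hp.ne', Real.rpow_sub hs,
    Real.mul_rpow hl.le hs.le, Real.mul_rpow hl.le hs.le, Real.rpow_natCast, Real.rpow_natCast]
  field_simp

/-- The hyperbolic `p`-energy density of a compactly supported function is integrable. -/
theorem integrableOn_hyperbolic_energy (hp : 0 < p) {u : EuclideanSpace ℝ (Fin n) → ℝ}
    (hu : ContDiff ℝ 1 u) (hsupp : tsupport u ⊆ ball (0 : EuclideanSpace ℝ (Fin n)) 1) :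
    IntegrableOn (fun x => ((1 - ‖x‖ ^ 2) / 2) ^ p * ‖fderiv ℝ u x‖ ^ p *
      (2 / (1 - ‖x‖ ^ 2)) ^ (n : ℝ)) (ball (0 : EuclideanSpace ℝ (Fin n)) 1) := by
  have hK : IsCompact (tsupport u) :=
    (isCompact_closedBall _ _).of_isClosed_subset (isClosed_tsupport u)
      (hsupp.trans ball_subset_closedBall)
  have hpos : ∀ x ∈ tsupport u, 1 - ‖x‖ ^ 2 ≠ 0 := fun x hx => by
    have := mem_ball_zero_iff.1 (hsupp hx)
    exact (sub_pos.2 (pow_lt_one₀ (norm_nonneg x) this two_ne_zero)).ne'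
  have hc : ContinuousOn (fun x => ((1 - ‖x‖ ^ 2) / 2) ^ p * ‖fderiv ℝ u x‖ ^ p *
      (2 / (1 - ‖x‖ ^ 2)) ^ (n : ℝ)) (tsupport u) := by
    refine ContinuousOn.mul (ContinuousOn.mul ?_ ?_) ?_
    · exact ContinuousOn.rpow_const (by fun_prop) fun _ _ => .inr hp.le
    · exact ContinuousOn.rpow_const
        (hu.continuous_fderiv one_ne_zero).norm.continuousOn fun _ _ => .inr hp.le
    · exact ContinuousOn.rpow_const (continuousOn_const.div (by fun_prop) hpos)
        fun _ _ => .inr n.cast_nonneg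
  refine (hc.integrableOn_compact hK).of_forall_sdiff_eq_zero measurableSet_ball fun x hx => ?_
  have : fderiv ℝ u x = 0 :=
    Function.notMem_support.1 fun hx' => hx.2 (support_fderiv_subset ℝ hx')
  simp [this, Real.zero_rpow hp.ne']

/-- The pointwise form of the sharp inequality. -/
theorem abs_le_hyperbolicMorreyConst_mul (hn : 2 ≤ n) (hp : (n : ℝ) < p)
    {u : EuclideanSpace ℝ (Fin n) → ℝ} (hu : ContDiff ℝ 1 u)
    (hsupp : tsupport u ⊆ ball (0 : EuclideanSpace ℝ (Fin n)) 1)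
    {a : EuclideanSpace ℝ (Fin n)} (ha : a ∈ ball (0 : EuclideanSpace ℝ (Fin n)) 1) :
    |u a| ≤ hyperbolicMorreyConst n p *
        (∫ x in ball (0 : EuclideanSpace ℝ (Fin n)) 1,
            ((1 - ‖x‖ ^ 2) / 2) ^ p * ‖fderiv ℝ u x‖ ^ p * (2 / (1 - ‖x‖ ^ 2)) ^ (n : ℝ)) ^
          (1 / p) := by
  have hn' : (2 : ℝ) ≤ n := by exact_mod_cast hn
  have hp1 : 0 < p - 1 := by linarith
  have hp0 : 0 < p := by linarith
  have : Nonempty (Fin n) := ⟨⟨0, by omega⟩⟩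
  have hu0 : ∀ x, ‖x‖ = 1 → u x = 0 := fun x hx => image_eq_zero_of_notMem_tsupport fun h => by
    simpa [hx] using hsupp h
  obtain ⟨T, lam, h, rfl⟩ := exists_isBallIsometry ha
  set F : EuclideanSpace ℝ (Fin n) → ℝ := fun x =>
    ((1 - ‖x‖ ^ 2) / 2) ^ p * ‖fderiv ℝ u x‖ ^ p * (2 / (1 - ‖x‖ ^ 2)) ^ (n : ℝ) with hF
  have hs : ∀ x ∈ ball (0 : EuclideanSpace ℝ (Fin n)) 1, 0 < (1 - ‖x‖ ^ 2) / 2 := fun x hx =>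
    half_pos (sub_pos.2 (pow_lt_one₀ (norm_nonneg x) (mem_ball_zero_iff.1 hx) two_ne_zero))
  have hF0 : ∀ x ∈ ball (0 : EuclideanSpace ℝ (Fin n)) 1, 0 ≤ F x := fun x hx => by
    have h1 := hs x hx
    have h2 : 0 < 2 / (1 - ‖x‖ ^ 2) := by rw [← inv_div]; exact inv_pos.2 h1
    positivity
  set I := ∫ x in ball (0 : EuclideanSpace ℝ (Fin n)) 1, F x
  have hI0 : 0 ≤ I := setIntegral_nonneg measurableSet_ball hF0
  set f : EuclideanSpace ℝ (Fin n) → ℝ≥0∞ := fun x =>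
    ENNReal.ofReal (‖fderiv ℝ u (T x)‖ * lam x * ((1 - ‖x‖ ^ 2) / 2) ^ ((p - n) / p)) with hf
  set g : EuclideanSpace ℝ (Fin n) → ℝ≥0∞ := fun x =>
    ENNReal.ofReal ((‖x‖ ^ (n - 1))⁻¹ * ((1 - ‖x‖ ^ 2) / 2) ^ (-((p - n) / p))) with hg
  have hfm : AEMeasurable f (volume.restrict (ball 0 1)) := by
    refine (ContinuousOn.aemeasurable ?_ measurableSet_ball).ennreal_ofReal
    refine ContinuousOn.mul ((((hu.continuous_fderiv one_ne_zero).comp_continuousOn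
      (h.continuousOn.mono ball_subset_closedBall)).norm).mul
      (h.continuousOn_factor.mono ball_subset_closedBall)) ?_
    exact ContinuousOn.rpow_const (by fun_prop) fun x hx => .inl (hs x hx).ne'
  have hgm : AEMeasurable g (volume.restrict (ball 0 1)) := by
    refine Measurable.aemeasurable ?_
    fun_prop
  have hfp : ∫⁻ x in ball 0 1, f x ^ p ≤ ENNReal.ofReal I := by
    rw [ofReal_integral_eq_lintegral_ofReal (integrableOn_hyperbolic_energy hp0 hu hsupp)
      (ae_restrict_of_forall_mem measurableSet_ball hF0)]
    refine (le_of_eq ?_).trans (h.lintegral_le fun x => ENNReal.ofReal (F x))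
    refine setLIntegral_congr_fun measurableSet_ball fun x hx => ?_
    have hl := h.factor_pos x (ball_subset_closedBall hx)
    have hsx := hs x hx
    simp only [hf]
    rw [ENNReal.ofReal_rpow_of_nonneg (by positivity) hp0.le,
      h.energy_density_eq hp0 (norm_nonneg _) hx, ENNReal.ofReal_mul (by positivity),
      finrank_euclideanSpace, Fintype.card_fin]
  have hpq : p.HolderConjugate (p / (p - 1)) := Real.HolderConjugate.conjExponent (by linarith)
  have key := h.toSphere_mul_ofReal_abs_le hu hu0
  rw [toSphere_univ_euclideanSpace (by omega), finrank_euclideanSpace, Fintype.card_fin,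
    setLIntegral_congr_fun (g := fun x => (f * g) x) measurableSet_ball fun x hx => by
      have hl := h.factor_pos x (ball_subset_closedBall hx)
      have hsx := hs x hx
      simp only [hf, hg, Pi.mul_apply]
      rw [← ENNReal.ofReal_mul (by positivity), Real.rpow_neg hsx.le]
      congr 1
      field_simp] at key
  replace key := key.trans ((ENNReal.lintegral_mul_le_Lp_mul_Lq _ hpq hfm hgm).trans
    (mul_le_mul_left (ENNReal.rpow_le_rpow hfp (by positivity)) _))
  rw [lintegral_riesz_kernel_rpow hn hp] at key
  have hV := unitBallVol_pos n
  have hB := ProbabilityTheory.beta_pos (α := (p - n) / (2 * (p - 1))) (β := (n - 1) / (p - 1))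
    (div_pos (by linarith) (by linarith)) (div_pos (by linarith) hp1)
  have hC : hyperbolicMorreyConst n p = (2 ^ ((n : ℝ) - 1) * (n * unitBallVol n)) ^ (-(1 / p)) *
      ProbabilityTheory.beta ((p - n) / (2 * (p - 1))) ((n - 1) / (p - 1)) ^ ((p - 1) / p) := by
    rw [hyperbolicMorreyConst, ProbabilityTheory.beta, mul_assoc]
    congr 4
    field_simp
    ring
  set B := ProbabilityTheory.beta ((p - n) / (2 * (p - 1))) ((n - 1) / (p - 1))
  set S := (n : ℝ) * unitBallVol n with hS
  have hS0 : 0 < S := mul_pos (by linarith) hV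
  rw [← ENNReal.ofReal_mul hS0.le, ← ENNReal.ofReal_mul hS0.le,
    ENNReal.ofReal_rpow_of_nonneg hI0 (by positivity),
    ENNReal.ofReal_rpow_of_nonneg (by positivity) (by positivity),
    ← ENNReal.ofReal_mul (by positivity), ENNReal.ofReal_le_ofReal_iff (by positivity)] at key
  refine le_of_mul_le_mul_left (key.trans_eq ?_) hS0
  rw [hC, one_div_div, Real.mul_rpow hS0.le (by positivity), Real.mul_rpow (by positivity) hB.le,
    Real.mul_rpow (by positivity) hS0.le, ← Real.rpow_mul two_pos.le, ← Real.rpow_mul two_pos.le,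
    show (p - 1) / p = 1 + -(1 / p) by field_simp; ring, Real.rpow_add hS0, Real.rpow_one,
    show -(((n : ℝ) - 1) / (p - 1)) * (1 + -(1 / p)) = (n - 1) * -(1 / p) by field_simp; ring]
  ring

end Estimate

/-- The sharp `L^∞` Sobolev inequality in `ℍⁿ` for `p > n`. -/
theorem mugelli_talenti_hyperbolic_sup (n : ℕ) (hn : 2 ≤ n) (p : ℝ) (hp : (n : ℝ) < p)
    (u : EuclideanSpace ℝ (Fin n) → ℝ) (hu : ContDiff ℝ (⊤ : ℕ∞) u)
    (hsupp : tsupport u ⊆ Metric.ball (0 : EuclideanSpace ℝ (Fin n)) 1) :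
    (⨆ x ∈ Metric.ball (0 : EuclideanSpace ℝ (Fin n)) 1, |u x|)
      ≤ hyperbolicMorreyConst n p *
        (∫ x in Metric.ball (0 : EuclideanSpace ℝ (Fin n)) 1,
            ((1 - ‖x‖ ^ 2) / 2) ^ p * ‖fderiv ℝ u x‖ ^ p * (2 / (1 - ‖x‖ ^ 2)) ^ (n : ℝ)) ^
          (1 / p) := by
  have h (x) (hx : x ∈ ball (0 : EuclideanSpace ℝ (Fin n)) 1) :=
    abs_le_hyperbolicMorreyConst_mul hn hp (hu.of_le (by norm_cast)) hsupp hx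
  have h0 := (abs_nonneg _).trans (h 0 (mem_ball_self one_pos))
  exact Real.iSup_le (fun x => Real.iSup_le (h x) h0) h0
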